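/- arXiv:2102.13542 — 6 statements merged into one kernel-verified Lean document; each statement's English description precedes it below -/
import Mathlib

section
/- Let G be a finitely generated group admitting an epimorphism h : G → ℤ onto the infinite cyclic group. Let S = {t} ∪ K be a finite generating set of G such that h(t) generates ℤ and K ⊆ Ker(h). Then the combinatorial Laplace operator on the Cayley graph of G with respect to S has no eigenfunction with finite support; if moreover G is amenable, it has no ℓ²-eigenfunction at all (i.e. no eigenvalue). -/
noncomputable section
open scoped symmDiff

/-- The combinatorial Laplacian of the Cayley graph `𝒞(G,S)`: every vertex `x`
has `2|S|` outgoing edges (for each `s ∈ S`, one edge towards `x·s` and one —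
the reversal of an edge originating at `x·s⁻¹` — towards `x·s⁻¹`), and
`Δφ(x) = φ(x) − (1/|E_x|) Σ_{e ∈ E_x} φ(t(e))`. -/
def cayleyLap {G : Type*} [Group G] [DecidableEq G] (S : Finset G) (φ : G → ℂ) (x : G) : ℂ :=
  φ x - (1 / (2 * (S.card : ℂ))) * ∑ s ∈ S, (φ (x * s) + φ (x * s⁻¹))

/-- A group is amenable iff it satisfies the F{\o}lner condition: for every
finite set `F ⊆ G` and every `ε > 0` there is a finite nonempty `Ω ⊆ G` with
`|gΩ ∆ Ω| ≤ ε·|Ω|` for every `g ∈ F`. -/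
def IsAmenable (G : Type*) [Group G] [DecidableEq G] : Prop :=
  ∀ (F : Finset G) (ε : ℝ), 0 < ε → ∃ Ω : Finset G, Ω.Nonempty ∧
    ∀ g ∈ F, (((Ω.image fun x => g * x) ∆ Ω).card : ℝ) ≤ ε * (Ω.card : ℝ)

open scoped InnerProductSpace

/-- One-sided unique continuation: an eigenfunction of the Laplacian that vanishes on a suitable
finite set of translates of `x`, all of strictly greater height, vanishes at `x`. -/
lemma exists_finset_determining {G : Type*} [Group G] [DecidableEq G]
    (h : G → ℤ) (hhom : ∀ a b : G, h (a * b) = h a + h b) (t : G) (K : Finset G)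
    (ht : AddSubgroup.closure {h t} = (⊤ : AddSubgroup ℤ)) (hK : ∀ k ∈ K, h k = 0) :
    ∃ F : Finset G, (∀ g ∈ F, 0 < h g) ∧ ∀ (c : ℂ) (f : G → ℂ),
      (∀ x, cayleyLap (insert t K) f x = c * f x) →
      ∀ x, (∀ g ∈ F, f (x * g) = 0) → f x = 0 := by
  have h1 : h 1 = 0 := by have := hhom 1 1; simp at this; omega
  have hinv : ∀ a, h a⁻¹ = -h a := fun a => by
    have := hhom a a⁻¹; rw [mul_inv_cancel, h1] at this; omega
  have hunit : h t = 1 ∨ h t = -1 := by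
    have : (1 : ℤ) ∈ AddSubgroup.closure {h t} := ht ▸ AddSubgroup.mem_top _
    obtain ⟨n, hn⟩ := AddSubgroup.mem_closure_singleton.1 this
    rw [smul_eq_mul, mul_comm] at hn
    exact Int.isUnit_iff.1 (IsUnit.of_mul_eq_one _ hn)
  have htK : t ∉ K := fun hmem => by have := hK t hmem; omega
  obtain ⟨τ, hτ, hττ⟩ : ∃ τ, (τ = t ∨ τ = t⁻¹) ∧ h τ = 1 := by
    rcases hunit with h' | h'
    · exact ⟨t, .inl rfl, h'⟩
    · exact ⟨t⁻¹, .inr rfl, by rw [hinv, h']; rfl⟩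
  refine ⟨insert τ (insert (τ * τ) (K.image (fun k => τ * k) ∪ K.image (fun k => τ * k⁻¹))),
    ?_, ?_⟩
  · intro g hg
    simp only [Finset.mem_insert, Finset.mem_union, Finset.mem_image] at hg
    rcases hg with rfl | rfl | ⟨k, hk, rfl⟩ | ⟨k, hk, rfl⟩ <;>
      simp_all
  · intro c f hf x hx
    have e0 : f (x * τ) = 0 := hx _ (by simp)
    have e1 : f (x * τ * τ) = 0 := by rw [mul_assoc]; exact hx _ (by simp)
    have e2 : ∑ k ∈ K, (f (x * τ * k) + f (x * τ * k⁻¹)) = 0 := by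
      refine Finset.sum_eq_zero fun k hk => ?_
      rw [mul_assoc, mul_assoc, hx (τ * k), hx (τ * k⁻¹), add_zero]
      · simp only [Finset.mem_insert, Finset.mem_union, Finset.mem_image]
        exact .inr (.inr (.inr ⟨k, hk, rfl⟩))
      · simp only [Finset.mem_insert, Finset.mem_union, Finset.mem_image]
        exact .inr (.inr (.inl ⟨k, hk, rfl⟩))
    have e := hf (x * τ)
    rw [cayleyLap, e0, Finset.sum_insert htK, e2, mul_zero, zero_sub, neg_eq_zero, mul_eq_zero,
      add_zero] at e
    have e3 := e.resolve_left (by simp)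
    rcases hτ with rfl | rfl
    · simpa [e1] using e3
    · simpa [e1] using e3

/-- Induction on a finite set, in order of decreasing height. -/
lemma Finset.forall_of_height_induction {α : Type*} (h : α → ℤ) (A : Finset α) {p : α → Prop}
    (hp : ∀ x ∈ A, (∀ y ∈ A, h x < h y → p y) → p x) : ∀ x ∈ A, p x := by
  by_contra! hcon
  classical
  obtain ⟨x, hx, hmax⟩ := (A.filter fun x => ¬ p x).exists_max_image h
    (by obtain ⟨x, hx, hpx⟩ := hcon; exact ⟨x, by simp [hx, hpx]⟩)
  rw [Finset.mem_filter] at hx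
  refine hx.2 (hp x hx.1 fun y hy hlt => ?_)
  by_contra hpy
  exact absurd (hmax y (by simp [hy, hpy])) (by omega)

/-- In an amenable group there are finite sets almost invariant under right translation. -/
lemma IsAmenable.exists_right_folner {G : Type*} [Group G] [DecidableEq G] (hG : IsAmenable G)
    (F : Finset G) {ε : ℝ} (hε : 0 < ε) :
    ∃ A : Finset G, A.Nonempty ∧
      ((A.filter fun x => ∃ g ∈ F, x * g ∉ A).card : ℝ) < ε * A.card := by
  obtain ⟨Ω, hΩ, hF⟩ := hG F (ε / (F.card + 1)) (by positivity)
  have hcard : (Ω.image (·⁻¹)).card = Ω.card := Finset.card_image_of_injective _ inv_injective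
  refine ⟨Ω.image (·⁻¹), hΩ.image _, ?_⟩
  have hsub : ((Ω.image (·⁻¹)).filter fun x => ∃ g ∈ F, x * g ∉ Ω.image (·⁻¹)) ⊆
      F.biUnion fun g => ((Ω.image fun x => g * x) ∆ Ω).image (·⁻¹) := by
    intro x hx
    rw [Finset.mem_filter, Finset.mem_image] at hx
    obtain ⟨⟨w, hw, rfl⟩, g, hg, hgx⟩ := hx
    refine Finset.mem_biUnion.2 ⟨g, hg, Finset.mem_image.2 ⟨w, ?_, rfl⟩⟩
    refine Finset.mem_symmDiff.2 (.inr ⟨hw, fun hmem => hgx ?_⟩)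
    obtain ⟨v, hv, rfl⟩ := Finset.mem_image.1 hmem
    exact Finset.mem_image.2 ⟨v, hv, by group⟩
  have hpos : (0 : ℝ) < Ω.card := by exact_mod_cast hΩ.card_pos
  calc _ ≤ ((F.biUnion fun g => ((Ω.image fun x => g * x) ∆ Ω).image (·⁻¹)).card : ℝ) := by
        exact_mod_cast Finset.card_le_card hsub
    _ ≤ ∑ g ∈ F, ((((Ω.image fun x => g * x) ∆ Ω).image (·⁻¹)).card : ℝ) := by
        exact_mod_cast Finset.card_biUnion_le
    _ ≤ ∑ g ∈ F, ε / (F.card + 1) * Ω.card := Finset.sum_le_sum fun g hg =>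
        le_trans (by exact_mod_cast Finset.card_image_le) (hF g hg)
    _ = (F.card / (F.card + 1)) * (ε * Ω.card) := by
        rw [Finset.sum_const, nsmul_eq_mul]; ring
    _ < 1 * (ε * Ω.card) := by
        gcongr
        rw [div_lt_one (by positivity)]; linarith
    _ = _ := by rw [one_mul, hcard]

/-- If a closed subspace `E` of `ℓ²` has, for each `x ∈ A`, an element of norm at most `C` whose
modulus at `x` is `r`, and if elements of `E` are determined on `A` by their values on `B`, then
`r² |A| ≤ C² |B|`. -/
lemma lp.card_le_of_determining {α : Type*} (E : Submodule ℂ (lp (fun _ : α => ℂ) 2))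
    (hE : IsClosed (E : Set (lp (fun _ : α => ℂ) 2))) (A B : Finset α) {r C : ℝ}
    (hr : 0 ≤ r) (hlarge : ∀ x ∈ A, ∃ f ∈ E, ‖f‖ ≤ C ∧ ‖f x‖ = r)
    (hdet : ∀ f ∈ E, (∀ x ∈ B, f x = 0) → ∀ x ∈ A, f x = 0) :
    r ^ 2 * A.card ≤ C ^ 2 * B.card := by
  classical
  have : CompleteSpace E := hE.completeSpace_coe
  let v : α → lp (fun _ : α => ℂ) 2 := fun x => E.starProjection (lp.single 2 x 1)
  have hvE : ∀ x, v x ∈ E := fun x => Submodule.starProjection_apply_mem _ _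
  have hv : ∀ x, ∀ f ∈ E, ⟪v x, f⟫_ℂ = f x := by
    intro x f hf
    rw [Submodule.inner_starProjection_left_eq_right, Submodule.starProjection_eq_self_iff.2 hf,
      lp.inner_single_left]
    simp
  let W : Submodule ℂ (lp (fun _ : α => ℂ) 2) := Submodule.span ℂ (A.image v : Finset _)
  have hWE : W ≤ E := Submodule.span_le.2 fun y hy => by
    obtain ⟨x, -, rfl⟩ := Finset.mem_image.1 (Finset.mem_coe.1 hy)
    exact hvE x
  have hvW : ∀ x ∈ A, v x ∈ W := fun x hx =>
    Submodule.subset_span (Finset.mem_coe.2 (Finset.mem_image_of_mem v hx))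
  have : FiniteDimensional ℂ W := FiniteDimensional.span_finset ℂ _
  let b := stdOrthonormalBasis ℂ W
  have hrank : Module.finrank ℂ W ≤ B.card := by
    let R : W →ₗ[ℂ] (B → ℂ) :=
      { toFun := fun f x => (f : lp (fun _ : α => ℂ) 2) x
        map_add' := fun f g => by ext; simp
        map_smul' := fun a f => by ext; simp }
    have hR : Function.Injective R := by
      rw [← LinearMap.ker_eq_bot, LinearMap.ker_eq_bot']
      intro f hf
      have hA := hdet f (hWE f.2) fun x hx => congrFun hf ⟨x, hx⟩
      have horth : W ≤ (ℂ ∙ (f : lp (fun _ : α => ℂ) 2))ᗮ := Submodule.span_le.2 fun y hy => by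
        obtain ⟨x, hx, rfl⟩ := Finset.mem_image.1 (Finset.mem_coe.1 hy)
        rw [SetLike.mem_coe, Submodule.mem_orthogonal_singleton_iff_inner_left, hv x f (hWE f.2)]
        exact hA x hx
      have := Submodule.mem_orthogonal_singleton_iff_inner_left.1 (horth f.2)
      exact Subtype.ext (inner_self_eq_zero.1 this)
    simpa using LinearMap.finrank_le_finrank_of_injective hR
  have hvnorm : ∀ x ∈ A, r ^ 2 ≤ C ^ 2 * ‖v x‖ ^ 2 := by
    intro x hx
    obtain ⟨f, hf, hfC, hfr⟩ := hlarge x hx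
    rw [← mul_pow]
    refine pow_le_pow_left₀ hr ?_ 2
    rw [← hfr, ← hv x f hf, mul_comm]
    exact (norm_inner_le_norm _ _).trans (by gcongr)
  have hvsum : ∀ x ∈ A, ‖v x‖ ^ 2 = ∑ i, ‖(b i : lp (fun _ : α => ℂ) 2) x‖ ^ 2 := by
    intro x hx
    have := b.sum_sq_norm_inner_left ⟨v x, hvW x hx⟩
    rw [Submodule.coe_norm] at this
    rw [← this]
    refine Finset.sum_congr rfl fun i _ => ?_
    rw [← hv x _ (hWE (b i).2), Submodule.coe_inner]
  have hbi : ∀ i, ∑ x ∈ A, ‖(b i : lp (fun _ : α => ℂ) 2) x‖ ^ 2 ≤ 1 := by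
    intro i
    have h1 := lp.sum_rpow_le_norm_rpow (p := 2) (by norm_num) (b i : lp (fun _ : α => ℂ) 2) A
    have h2 : ‖(b i : lp (fun _ : α => ℂ) 2)‖ = 1 := b.orthonormal.1 i
    rw [h2] at h1
    simpa using h1
  calc r ^ 2 * A.card = ∑ x ∈ A, r ^ 2 := by rw [Finset.sum_const, nsmul_eq_mul, mul_comm]
    _ ≤ ∑ x ∈ A, C ^ 2 * ‖v x‖ ^ 2 := Finset.sum_le_sum hvnorm
    _ = C ^ 2 * ∑ i, ∑ x ∈ A, ‖(b i : lp (fun _ : α => ℂ) 2) x‖ ^ 2 := by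
        rw [← Finset.mul_sum, Finset.sum_congr rfl hvsum, Finset.sum_comm]
    _ ≤ C ^ 2 * ∑ i : Fin (Module.finrank ℂ W), 1 := by
        gcongr with i; exact hbi i
    _ ≤ C ^ 2 * B.card := by
        gcongr; simpa using hrank

/-- The `ℓ²`-eigenspace of the Laplacian. -/
def cayleyEigenspace {G : Type*} [Group G] [DecidableEq G] (S : Finset G) (c : ℂ) :
    Submodule ℂ (lp (fun _ : G => ℂ) 2) where
  carrier := {f | ∀ x, cayleyLap S f x = c * f x}
  zero_mem' := fun x => by simp [cayleyLap]
  add_mem' := fun {f g} hf hg x => by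
    have h1 := hf x
    have h2 := hg x
    simp only [cayleyLap, lp.coeFn_add, Pi.add_apply, Finset.sum_add_distrib] at *
    linear_combination h1 + h2
  smul_mem' := fun a f hf x => by
    have h1 := hf x
    simp only [cayleyLap, lp.coeFn_smul, Pi.smul_apply, smul_eq_mul, Finset.sum_add_distrib,
      ← Finset.mul_sum] at *
    linear_combination a * h1

lemma isClosed_cayleyEigenspace {G : Type*} [Group G] [DecidableEq G] (S : Finset G) (c : ℂ) :
    IsClosed (cayleyEigenspace S c : Set (lp (fun _ : G => ℂ) 2)) := by
  have hev : ∀ x : G, Continuous fun f : lp (fun _ : G => ℂ) 2 => f x := fun x =>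
    (continuous_apply x).comp (lp.uniformContinuous_coe (p := 2)).continuous
  have : (cayleyEigenspace S c : Set (lp (fun _ : G => ℂ) 2)) =
      ⋂ x, {f : lp (fun _ : G => ℂ) 2 | cayleyLap S f x = c * f x} := by
    ext f; simp [cayleyEigenspace]
  rw [this]
  refine isClosed_iInter fun x => isClosed_eq ?_ (continuous_const.mul (hev x))
  unfold cayleyLap
  exact (hev x).sub (continuous_const.mul
    (continuous_finsetSum _ fun s _ => (hev _).add (hev _)))

/-- (Cayley graphs of indicable amenable groups without
eigenvalue.) Let `G` be a finitely generated group with an epimorphism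
`h : G → ℤ`. Let `S = {t} ∪ K` be a finite generating set of `G` such that
`h(t)` generates `ℤ` and `K ⊆ Ker h`. Then the combinatorial Laplace operator
on the Cayley graph of `(G,S)` has no eigenfunction with finite support; if
moreover `G` is amenable, it has no square-summable eigenfunction at all. -/
theorem cayley_no_eigenvalue {G : Type*} [Group G] [DecidableEq G]
    (h : G → ℤ) (hhom : ∀ a b : G, h (a * b) = h a + h b) (hsurj : Function.Surjective h)
    (t : G) (K : Finset G)
    (hgen : Subgroup.closure (insert t (K : Set G)) = ⊤)
    (ht : AddSubgroup.closure {h t} = (⊤ : AddSubgroup ℤ))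
    (hK : ∀ k ∈ K, h k = 0) :
    (∀ (lam : ℝ) (φ : G → ℂ), (Function.support φ).Finite →
      (∀ x : G, cayleyLap (insert t K) φ x = (lam : ℂ) * φ x) → φ = 0) ∧
    (IsAmenable G →
      ∀ (lam : ℝ) (φ : G → ℂ), Summable (fun x : G => ‖φ x‖ ^ 2) →
        (∀ x : G, cayleyLap (insert t K) φ x = (lam : ℂ) * φ x) → φ = 0) := by
  obtain ⟨F, hF, hdet⟩ := exists_finset_determining h hhom t K ht hK
  refine ⟨fun lam φ hfin hφ => ?_, fun hG lam φ hsum hφ => ?_⟩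
  · have key := Finset.forall_of_height_induction (p := fun x => φ x = 0) h hfin.toFinset
      fun x _ ih => hdet lam φ hφ x fun g hg => by
        by_contra hne
        exact hne (ih _ (by simpa using hne) (by have := hF g hg; rw [hhom]; omega))
    funext x
    by_contra hne
    exact hne (key x (by simpa using hne))
  · by_contra hne
    obtain ⟨x₀, hx₀⟩ := Function.ne_iff.1 hne
    have hmem : ∀ a : G, Memℓp (fun x => φ (a * x)) 2 := fun a => by
      refine memℓp_gen ?_
      simpa [Function.comp_def] using (Equiv.mulLeft a).summable_iff.2 hsum
    let T : G → lp (fun _ : G => ℂ) 2 := fun a => ⟨fun x => φ (a * x), hmem a⟩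
    have hT : ∀ a x, T a x = φ (a * x) := fun _ _ => rfl
    have hTnorm : ∀ a, ‖T a‖ = ‖T 1‖ := fun a => by
      rw [lp.norm_eq_tsum_rpow (by norm_num), lp.norm_eq_tsum_rpow (by norm_num)]
      simp only [hT, one_mul]
      exact congrArg (· ^ _) ((Equiv.mulLeft a).tsum_eq fun x => ‖φ x‖ ^ (2 : ENNReal).toReal)
    have hTE : ∀ a, T a ∈ cayleyEigenspace (insert t K) (lam : ℂ) := fun a x => by
      simpa only [cayleyLap, hT, mul_assoc] using hφ (a * x)
    have hC : 0 < ‖T 1‖ := norm_pos_iff.2 fun h0 => hx₀ <| by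
      have := hT 1 x₀
      rw [h0] at this
      simpa using this.symm
    have hr : 0 < ‖φ x₀‖ := norm_pos_iff.2 hx₀
    obtain ⟨A, hA, hAB⟩ := hG.exists_right_folner F (ε := ‖φ x₀‖ ^ 2 / ‖T 1‖ ^ 2) (by positivity)
    have hle := lp.card_le_of_determining _ (isClosed_cayleyEigenspace (insert t K) (lam : ℂ)) A
      (A.filter fun x => ∃ g ∈ F, x * g ∉ A) hr.le
      (fun x _ => ⟨T (x₀ * x⁻¹), hTE _, (hTnorm _).le, by simp [hT]⟩)
      (fun f hf hB => Finset.forall_of_height_induction h A fun x hx ih => by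
        by_cases hxB : ∃ g ∈ F, x * g ∉ A
        · exact hB x (Finset.mem_filter.2 ⟨hx, hxB⟩)
        · push Not at hxB
          exact hdet lam f hf x fun g hg =>
            ih _ (hxB g hg) (by have := hF g hg; rw [hhom]; omega))
    rw [div_mul_eq_mul_div, lt_div_iff₀ (by positivity), mul_comm] at hAB
    exact absurd hle hAB.not_ge
end
end

section
/- Let Γ be a connected weighted graph satisfying the Sunada–Sy condition and H = Δ + q a Schrödinger operator with bounded real potential q. Let Ω ⊆ V, λ ∈ ℝ, and suppose φ ∈ ℓ²(V, m_V) satisfies Hφ = λφ and φ vanishes on the 2-boundary ∂₂Ω. Then: (1) the function P_Ω φ either vanishes identically or is again a λ-eigenfunction of H; (2) if moreover H satisfies λ-uniqueness on Ω, then P_Ω φ vanishes identically. -/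
noncomputable section

/-- A graph in the sense of Serre, together with strictly positive weights on
vertices and (oriented) edges, the edge weight being symmetric. -/
structure WSGraph (V : Type*) (E : Type*) where
  o : E → V
  t : E → V
  bar : E → E
  bar_ne : ∀ e, bar e ≠ e
  bar_bar : ∀ e, bar (bar e) = e
  o_bar : ∀ e, o (bar e) = t e
  t_bar : ∀ e, t (bar e) = o e
  mV : V → ℝ
  mE : E → ℝ
  mV_pos : ∀ x, 0 < mV x
  mE_pos : ∀ e, 0 < mE e
  mE_symm : ∀ e, mE (bar e) = mE e

namespace WSGraph

variable {V E : Type*}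

/-- The type of oriented edges with origin `x`. -/
def edgesAt (Γ : WSGraph V E) (x : V) : Type _ := {e : E // Γ.o e = x}

/-- The Sunada–Sy condition. -/
def SunadaSy (Γ : WSGraph V E) : Prop :=
  (∀ x : V, Summable fun e : Γ.edgesAt x => Γ.mE e.1) ∧
  ∃ C : ℝ, ∀ x : V, (∑' e : Γ.edgesAt x, Γ.mE e.1) / Γ.mV x ≤ C

/-- Membership in `ℓ²(V, m_V)`. -/
def MemL2V (Γ : WSGraph V E) (φ : V → ℂ) : Prop :=
  Summable fun x => ‖φ x‖ ^ 2 * Γ.mV x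

/-- Membership in `ℓ²(E, m_E)` (anti-symmetric square-summable functions). -/
def MemL2E (Γ : WSGraph V E) (α : E → ℂ) : Prop :=
  (∀ e, α (Γ.bar e) = -α e) ∧ Summable fun e => ‖α e‖ ^ 2 * Γ.mE e

/-- The hermitian product on `ℓ²(V, m_V)`: `⟨φ,ψ⟩ = ∑ φ(x) conj(ψ(x)) m_V(x)`. -/
def innerV (Γ : WSGraph V E) (φ ψ : V → ℂ) : ℂ :=
  ∑' x : V, φ x * (starRingEnd ℂ) (ψ x) * (Γ.mV x : ℂ)

/-- The hermitian product on `ℓ²(E, m_E)`: `⟨α,β⟩ = (1/2) ∑ α(e) conj(β(e)) m_E(e)`. -/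
def innerE (Γ : WSGraph V E) (α β : E → ℂ) : ℂ :=
  (1 / 2 : ℂ) * ∑' e : E, α e * (starRingEnd ℂ) (β e) * (Γ.mE e : ℂ)

/-- The coboundary operator `dφ(e) = φ(t(e)) − φ(o(e))`. -/
def cobdry (Γ : WSGraph V E) (φ : V → ℂ) : E → ℂ := fun e => φ (Γ.t e) - φ (Γ.o e)

/-- Adjacency: there is an edge with origin `x` and terminus `y`. -/
def Adj (Γ : WSGraph V E) (x y : V) : Prop := ∃ e : E, Γ.o e = x ∧ Γ.t e = y

/-- Connectivity of the graph. -/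
def Connected (Γ : WSGraph V E) : Prop := ∀ x y : V, Relation.ReflTransGen Γ.Adj x y

/-- The path metric on the vertex set of a connected graph. -/
def pathDist (Γ : WSGraph V E) (x y : V) : ℕ :=
  sInf {n : ℕ | ∃ f : ℕ → V, f 0 = x ∧ f n = y ∧ ∀ i < n, Γ.Adj (f i) (f (i + 1))}

/-- The closed ball of radius `r` around `x` for the path metric. -/
def ball (Γ : WSGraph V E) (x : V) (r : ℕ) : Set V := {y | Γ.pathDist x y ≤ r}

/-- The thick boundary `∂_r Ω = {x ∈ Ω : d(x, V∖Ω) ≤ r}`. -/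
def thickBdry (Γ : WSGraph V E) (r : ℕ) (Ω : Set V) : Set V :=
  {x ∈ Ω | ∃ y ∉ Ω, Γ.pathDist x y ≤ r}

/-- The Laplace operator `Δ = d*d`, via its pointwise ("key") formula. -/
def lap (Γ : WSGraph V E) (φ : V → ℂ) (x : V) : ℂ :=
  (((∑' e : Γ.edgesAt x, Γ.mE e.1) / Γ.mV x : ℝ) : ℂ) * φ x
    - (1 / (Γ.mV x : ℂ)) * ∑' e : Γ.edgesAt x, φ (Γ.t e.1) * (Γ.mE e.1 : ℂ)

/-- The Schrödinger operator `H = Δ + q`. -/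
def schrod (Γ : WSGraph V E) (q : V → ℝ) (φ : V → ℂ) (x : V) : ℂ :=
  Γ.lap φ x + (q x : ℂ) * φ x

/-- `λ`-uniqueness of `H = Δ + q` on `Ω`: the only `λ`-eigenfunction vanishing
outside of `Ω` is the zero function. -/
def LUnique (Γ : WSGraph V E) (q : V → ℝ) (lam : ℝ) (Ω : Set V) : Prop :=
  ∀ φ : V → ℂ, Γ.MemL2V φ → (∀ x, Γ.schrod q φ x = (lam : ℂ) * φ x) →
    (∀ x ∉ Ω, φ x = 0) → ∀ x, φ x = 0

end WSGraph

namespace WSGraph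

variable {V E : Type*}

lemma pathDist_le (Γ : WSGraph V E) {x y : V} {n : ℕ} (f : ℕ → V) (h0 : f 0 = x) (hn : f n = y)
    (hf : ∀ i < n, Γ.Adj (f i) (f (i + 1))) : Γ.pathDist x y ≤ n :=
  Nat.sInf_le ⟨f, h0, hn, hf⟩

lemma Adj.symm {Γ : WSGraph V E} {x y : V} (h : Γ.Adj x y) : Γ.Adj y x := by
  obtain ⟨e, rfl, rfl⟩ := h
  exact ⟨Γ.bar e, Γ.o_bar e, Γ.t_bar e⟩

lemma pathDist_self (Γ : WSGraph V E) (x : V) : Γ.pathDist x x = 0 :=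
  Nat.le_zero.mp (Γ.pathDist_le (fun _ => x) rfl rfl (by simp))

lemma Adj.pathDist_le_one {Γ : WSGraph V E} {x y : V} (h : Γ.Adj x y) : Γ.pathDist x y ≤ 1 := by
  refine Γ.pathDist_le (fun i => if i = 0 then x else y) rfl rfl fun i hi => ?_
  obtain rfl : i = 0 := by omega
  simpa using h

lemma Adj.pathDist_le_two {Γ : WSGraph V E} {x y z : V} (hxy : Γ.Adj x y) (hyz : Γ.Adj y z) :
    Γ.pathDist x z ≤ 2 := by
  refine Γ.pathDist_le (fun i => if i = 0 then x else if i = 1 then y else z) rfl rfl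
    fun i hi => ?_
  obtain rfl | rfl : i = 0 ∨ i = 1 := by omega
  · simpa using hxy
  · simpa using hyz

/-- The Schrödinger operator is local: `Hφ(x)` depends only on `φ` at `x` and its neighbours. -/
lemma schrod_congr (Γ : WSGraph V E) (q : V → ℝ) {φ ψ : V → ℂ} {x : V} (hx : φ x = ψ x)
    (h : ∀ y, Γ.Adj x y → φ y = ψ y) : Γ.schrod q φ x = Γ.schrod q ψ x := by
  have he : ∀ e : Γ.edgesAt x, φ (Γ.t e.1) = ψ (Γ.t e.1) := fun e => h _ ⟨e.1, e.2, rfl⟩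
  simp only [schrod, lap, hx, he]

lemma schrod_zero (Γ : WSGraph V E) (q : V → ℝ) (x : V) : Γ.schrod q 0 x = 0 := by
  simp [schrod, lap]

lemma MemL2V.indicator {Γ : WSGraph V E} {φ : V → ℂ} (hφ : Γ.MemL2V φ) (Ω : Set V) :
    Γ.MemL2V (Ω.indicator φ) := by
  refine Summable.of_nonneg_of_le (fun x => ?_) (fun x => ?_) hφ
  · have := (Γ.mV_pos x).le
    positivity
  · have := (Γ.mV_pos x).le
    gcongr
    exact norm_indicator_le_norm_self φ x

/-- Cutting off an eigenfunction that vanishes on the `2`-boundary of `Ω` preserves the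
eigenvalue equation. -/
lemma schrod_indicator_of_vanish (Γ : WSGraph V E) (q : V → ℝ) (Ω : Set V) (lam : ℂ) (φ : V → ℂ)
    (heig : ∀ x, Γ.schrod q φ x = lam * φ x) (hvanish : ∀ x ∈ Γ.thickBdry 2 Ω, φ x = 0) (x : V) :
    Γ.schrod q (Ω.indicator φ) x = lam * Ω.indicator φ x := by
  have key : ∀ y z, z ∉ Ω → Γ.pathDist y z ≤ 2 → Ω.indicator φ y = 0 := fun y z hz hyz =>
    Set.indicator_apply_eq_zero.mpr fun hy => hvanish y ⟨hy, z, hz, hyz⟩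
  by_cases h : ∃ z ∉ Ω, z = x ∨ Γ.Adj x z
  · obtain ⟨z, hz, hxz⟩ := h
    have hx : Ω.indicator φ x = 0 := by
      refine key x z hz ?_
      obtain rfl | hxz := hxz
      · simp [pathDist_self]
      · exact hxz.pathDist_le_one.trans one_le_two
    have hnbr : ∀ y, Γ.Adj x y → Ω.indicator φ y = 0 := by
      intro y hy
      refine key y z hz ?_
      obtain rfl | hxz := hxz
      · exact hy.symm.pathDist_le_one.trans one_le_two
      · exact hy.symm.pathDist_le_two hxz
    rw [Γ.schrod_congr q (ψ := 0) hx hnbr, schrod_zero, hx, mul_zero]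
  · push Not at h
    have hΩ : ∀ y, y = x ∨ Γ.Adj x y → y ∈ Ω := fun y hy => by
      by_contra hyΩ
      exact hy.elim (h y hyΩ).1 (h y hyΩ).2
    have hx := Set.indicator_of_mem (hΩ x (.inl rfl)) φ
    rw [Γ.schrod_congr q hx fun y hy => Set.indicator_of_mem (hΩ y (.inr hy)) φ, heig, hx]

end WSGraph

open WSGraph in
/-- (Cutting and pasting eigenfunctions.) Let `Γ` be a
connected weighted graph satisfying the Sunada–Sy condition and `H = Δ + q` a
Schrödinger operator with bounded real potential `q`. Let `Ω ⊆ V`, `λ ∈ ℝ`,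
and suppose `φ ∈ ℓ²(V, m_V)` satisfies `Hφ = λφ` and `φ` vanishes on `∂₂Ω`.
Then: (1) `P_Ω φ` either vanishes identically or is again a `λ`-eigenfunction
of `H`; (2) if moreover `H` satisfies `λ`-uniqueness on `Ω`, then `P_Ω φ`
vanishes identically. (Here `P_Ω φ = 1_Ω · φ` is the orthogonal projection onto
functions supported in `Ω`.) -/
theorem cutting_and_pasting {V E : Type*} (Γ : WSGraph V E)
    (hconn : Γ.Connected) (hSS : Γ.SunadaSy)
    (q : V → ℝ) (hq : ∃ C : ℝ, ∀ x : V, |q x| ≤ C)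
    (Ω : Set V) (lam : ℝ) (φ : V → ℂ) (hφ : Γ.MemL2V φ)
    (heig : ∀ x : V, Γ.schrod q φ x = (lam : ℂ) * φ x)
    (hvanish : ∀ x ∈ Γ.thickBdry 2 Ω, φ x = 0) :
    (Set.indicator Ω φ = 0 ∨
      (Γ.MemL2V (Set.indicator Ω φ) ∧
        ∀ x : V, Γ.schrod q (Set.indicator Ω φ) x = (lam : ℂ) * Set.indicator Ω φ x)) ∧
    (Γ.LUnique q lam Ω → Set.indicator Ω φ = 0) := by
  have hL2 := hφ.indicator Ω
  have heig' := Γ.schrod_indicator_of_vanish q Ω lam φ heig hvanish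
  exact ⟨.inr ⟨hL2, heig'⟩, fun huniq => funext <|
    huniq _ hL2 heig' fun x hx => Set.indicator_of_notMem hx φ⟩
end
end

section
/- Let Γ be a connected weighted graph satisfying the Sunada–Sy condition and H a Schrödinger operator on Γ with bounded real potential. If a subset Ω of the vertex set V admits a one-by-one exhaustion, then H satisfies λ-uniqueness on Ω for every λ ∈ ℝ. -/
noncomputable section

/-- A one-by-one exhaustion `(V_n)` of a subset `Ω` of the vertex set:
`V₀ = V∖Ω`; each `V_{n+1} = V_n ∪ B(x_n,1)` for some `x_n ∈ V_n`; at each step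
either exactly one vertex is added or `V_n` is already everything; and the
union of the `V_n` is the whole vertex set. -/
def WSGraph.OneByOne {V E : Type*} (Γ : WSGraph V E) (Ω : Set V) (W : ℕ → Set V) : Prop :=
  W 0 = Ωᶜ ∧
  (∀ n, W n ⊆ W (n + 1)) ∧
  (∀ n, ∃ x ∈ W n, W (n + 1) = W n ∪ Γ.ball x 1) ∧
  (∀ n, (W (n + 1) \ W n).encard = 1 ∨ W n = Set.univ) ∧
  (⋃ n, W n) = Set.univ

namespace WSGraph

variable {V E : Type*}

/-- A chain of adjacent vertices gives a path of some finite length. -/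
lemma exists_path (Γ : WSGraph V E) {x y : V} (h : Relation.ReflTransGen Γ.Adj x y) :
    ∃ n : ℕ, ∃ f : ℕ → V, f 0 = x ∧ f n = y ∧ ∀ i < n, Γ.Adj (f i) (f (i + 1)) := by
  induction h using Relation.ReflTransGen.head_induction_on with
  | refl => exact ⟨0, fun _ => y, rfl, rfl, by simp⟩
  | @head a c hac _ ih =>
    obtain ⟨n, f, h0, hn, hf⟩ := ih
    refine ⟨n + 1, fun i => Nat.casesOn i a f, rfl, hn, ?_⟩
    rintro (_ | i) hi
    · simpa [h0] using hac
    · exact hf i (by omega)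

/-- Neighbours lie in the unit ball. -/
lemma mem_ball_one_of_adj (Γ : WSGraph V E) {x y : V} (h : Γ.Adj x y) : y ∈ Γ.ball x 1 := by
  refine Nat.sInf_le ⟨fun i => Nat.casesOn i x fun _ => y, rfl, rfl, fun i hi => ?_⟩
  obtain rfl : i = 0 := by omega
  exact h

/-- In a connected graph, points of the unit ball other than the centre are neighbours. -/
lemma Connected.adj_of_mem_ball_one {Γ : WSGraph V E} (hconn : Γ.Connected) {x y : V}
    (hy : y ∈ Γ.ball x 1) (hne : x ≠ y) : Γ.Adj x y := by
  obtain ⟨f, h0, hn, hf⟩ := Nat.sInf_mem (Γ.exists_path (hconn x y))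
  change Γ.pathDist x y ≤ 1 at hy
  change f (Γ.pathDist x y) = y at hn
  change ∀ i < Γ.pathDist x y, _ at hf
  rcases Nat.le_one_iff_eq_zero_or_eq_one.mp hy with h | h
  · exact absurd (h0.symm.trans (h ▸ hn)) hne
  · rw [h] at hn hf
    simpa [h0, hn] using hf 0 one_pos

/-- If an eigenfunction vanishes at `x`, then its weighted sum over the neighbours is zero. -/
lemma tsum_eq_zero_of_schrod_eq (Γ : WSGraph V E) {q : V → ℝ} {φ : V → ℂ} {lam : ℝ} {x : V}
    (h : Γ.schrod q φ x = (lam : ℂ) * φ x) (hx : φ x = 0) :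
    ∑' e : Γ.edgesAt x, φ (Γ.t e.1) * (Γ.mE e.1 : ℂ) = 0 := by
  have hm : (Γ.mV x : ℂ) ≠ 0 := by exact_mod_cast (Γ.mV_pos x).ne'
  simpa [schrod, lap, hx, hm] using h

/-- An eigenfunction vanishing at `x` and at all neighbours of `x` but one vanishes at the
remaining neighbour. -/
lemma eq_zero_of_adj (Γ : WSGraph V E) {q : V → ℝ} {φ : V → ℂ} {lam : ℝ} {x y : V}
    (hsum : Summable fun e : Γ.edgesAt x => Γ.mE e.1)
    (h : Γ.schrod q φ x = (lam : ℂ) * φ x) (hx : φ x = 0) (hxy : Γ.Adj x y)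
    (hz : ∀ z, Γ.Adj x z → z ≠ y → φ z = 0) : φ y = 0 := by
  classical
  have htsum := Γ.tsum_eq_zero_of_schrod_eq h hx
  let w : Γ.edgesAt x → ℝ := fun e => if Γ.t e.1 = y then Γ.mE e.1 else 0
  have hw0 : ∀ e, 0 ≤ w e := fun e => by
    dsimp only [w]
    split_ifs
    exacts [(Γ.mE_pos _).le, le_rfl]
  have hws : Summable w := hsum.of_nonneg_of_le hw0 fun e => by
    dsimp only [w]
    split_ifs
    exacts [le_rfl, (Γ.mE_pos _).le]
  obtain ⟨e₀, ho, ht⟩ := hxy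
  have hpos : 0 < ∑' e, w e :=
    hws.tsum_pos hw0 ⟨e₀, ho⟩ (by simpa [w, ht] using Γ.mE_pos e₀)
  have hterm : ∀ e : Γ.edgesAt x, φ (Γ.t e.1) * (Γ.mE e.1 : ℂ) = φ y * (w e : ℂ) := fun e => by
    by_cases he : Γ.t e.1 = y
    · simp [w, he]
    · simp [w, he, hz _ ⟨e.1, e.2, rfl⟩ he]
  rw [tsum_congr hterm, tsum_mul_left, ← Complex.ofReal_tsum] at htsum
  exact (mul_eq_zero.mp htsum).resolve_right (by exact_mod_cast hpos.ne')

end WSGraph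

open WSGraph in
/-- (One-by-one exhaustion implies `λ`-uniqueness.) Let `Γ` be
a connected weighted graph satisfying the Sunada–Sy condition and `H = Δ + q` a
Schrödinger operator with bounded real potential. If `Ω ⊆ V` admits a
one-by-one exhaustion, then `H` satisfies `λ`-uniqueness on `Ω` for every
`λ ∈ ℝ`. -/
theorem oneByOne_implies_lambdaUniqueness {V E : Type*} (Γ : WSGraph V E)
    (hconn : Γ.Connected) (hSS : Γ.SunadaSy)
    (q : V → ℝ) (hq : ∃ C : ℝ, ∀ x : V, |q x| ≤ C)
    (Ω : Set V) (hexh : ∃ W : ℕ → Set V, Γ.OneByOne Ω W) :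
    ∀ lam : ℝ, Γ.LUnique q lam Ω := by
  obtain ⟨W, h0, -, hstep, hone, hunion⟩ := hexh
  intro lam φ _ heig hvan
  have key : ∀ n, ∀ z ∈ W n, φ z = 0 := by
    intro n
    induction n with
    | zero =>
      intro z hz
      rw [h0] at hz
      exact hvan z hz
    | succ n ih =>
      obtain ⟨x, hx, hW⟩ := hstep n
      rcases hone n with h | h
      · obtain ⟨y, hy⟩ := Set.encard_eq_one.mp h
        have hiff : ∀ z, z ∈ W (n + 1) → z ≠ y → z ∈ W n := fun z hz hzy => by
          by_contra hzn
          have : z ∈ W (n + 1) \ W n := ⟨hz, hzn⟩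
          exact hzy (by simpa [hy] using this)
        have hymem : y ∈ W (n + 1) \ W n := hy ▸ Set.mem_singleton y
        have hball : y ∈ Γ.ball x 1 := by
          have := hymem.1
          rw [hW] at this
          exact this.resolve_left hymem.2
        have hne : x ≠ y := fun hxy => hymem.2 (hxy ▸ hx)
        have hφy : φ y = 0 := Γ.eq_zero_of_adj (hSS.1 x) (heig x) (ih x hx)
          (hconn.adj_of_mem_ball_one hball hne) fun z hxz hzy =>
            ih z (hiff z (hW ▸ Or.inr (Γ.mem_ball_one_of_adj hxz)) hzy)
        intro z hz
        by_cases hzy : z = y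
        · rw [hzy, hφy]
        · exact ih z (hiff z hz hzy)
      · exact fun z _ => ih z (h ▸ Set.mem_univ z)
  intro z
  have hz : z ∈ ⋃ n, W n := hunion ▸ Set.mem_univ z
  obtain ⟨n, hn⟩ := Set.mem_iUnion.mp hz
  exact key n z hn
end
end

section
/- Let Γ be a connected graph with vertex set V and path metric d admitting a height function h : V → ℤ satisfying: (A) |h(x) − h(y)| ≤ d(x,y) for all x,y ∈ V; (B) for each b ∈ V there exists exactly one c ∈ V with d(b,c) = 1 and h(c) = h(b) + 1; (C) for each b ∈ V there exists at least one a ∈ V with d(a,b) = 1 and h(a) = h(b) − 1. If Γ carries weights satisfying the Sunada–Sy condition and H = Δ + q is a Schrödinger operator with bounded real potential q, then H satisfies λ-uniqueness, for every λ ∈ ℝ, on every subset Ω ⊆ V with inf_{ω ∈ Ω} h(ω) > −∞. -/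
noncomputable section

namespace WSGraph

variable {V E : Type*}

theorem pathDist_le_one_of_adj (Γ : WSGraph V E) {x y : V} (hxy : Γ.Adj x y) :
    Γ.pathDist x y ≤ 1 := by
  refine Nat.sInf_le ⟨fun n => if n = 0 then x else y, by simp, by simp, ?_⟩
  intro i hi
  obtain rfl : i = 0 := by omega
  simpa using hxy

theorem adj_of_pathDist_eq_one (Γ : WSGraph V E) {x y : V} (hxy : Γ.pathDist x y = 1) :
    Γ.Adj x y := by
  have hmem := Nat.sInf_mem (Nat.nonempty_of_sInf_eq_succ hxy)
  change Γ.pathDist x y ∈ _ at hmem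
  rw [hxy] at hmem
  obtain ⟨f, h0, h1, hf⟩ := hmem
  simpa [h0, h1] using hf 0 one_pos

/-- If an eigenfunction vanishes at `b` and at all neighbours of `b` except possibly the
neighbour `c`, then it vanishes at `c` too. -/
theorem eq_zero_of_schrod_eq (Γ : WSGraph V E) {q : V → ℝ} {lam : ℝ} {φ : V → ℂ} {b c : V}
    (hsum : Summable fun e : Γ.edgesAt b => Γ.mE e.1)
    (hφ : Γ.schrod q φ b = (lam : ℂ) * φ b) (hb : φ b = 0) (hbc : Γ.Adj b c)
    (hne : ∀ y, Γ.Adj b y → y ≠ c → φ y = 0) : φ c = 0 := by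
  classical
  obtain ⟨e₀, ho, ht⟩ := hbc
  let w : Γ.edgesAt b → ℝ := fun e => if Γ.t e.1 = c then Γ.mE e.1 else 0
  have w_nonneg : ∀ e, 0 ≤ w e := fun e => by
    dsimp only [w]
    split_ifs
    exacts [(Γ.mE_pos _).le, le_rfl]
  have w_le : ∀ e, w e ≤ Γ.mE e.1 := fun e => by
    dsimp only [w]
    split_ifs
    exacts [le_rfl, (Γ.mE_pos _).le]
  have w_pos : 0 < ∑' e, w e :=
    (hsum.of_nonneg_of_le w_nonneg w_le).tsum_pos w_nonneg ⟨e₀, ho⟩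
      (by simpa [w, ht] using Γ.mE_pos e₀)
  have key : (∑' e : Γ.edgesAt b, φ (Γ.t e.1) * (Γ.mE e.1 : ℂ)) = φ c * ((∑' e, w e : ℝ) : ℂ) := by
    rw [Complex.ofReal_tsum, ← tsum_mul_left]
    refine tsum_congr fun e => ?_
    by_cases hec : Γ.t e.1 = c
    · simp [w, hec]
    · simp [w, hec, hne _ ⟨e.1, e.2, rfl⟩ hec]
  have hm : (Γ.mV b : ℂ) ≠ 0 := Complex.ofReal_ne_zero.2 (Γ.mV_pos b).ne'
  have hw : ((∑' e, w e : ℝ) : ℂ) ≠ 0 := Complex.ofReal_ne_zero.2 w_pos.ne'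
  rw [schrod, lap, key, hb] at hφ
  simp only [mul_zero, zero_sub, add_zero, neg_eq_zero, mul_eq_zero, one_div, inv_eq_zero] at hφ
  tauto

end WSGraph

open WSGraph in
/-- (Height functions bring `λ`-uniqueness.) Let `Γ` be a
connected graph admitting a height function `h : V → ℤ` satisfying conditions
(A), (B), (C). If `Γ` carries weights satisfying the Sunada–Sy condition and
`H = Δ + q` is a Schrödinger operator with bounded real potential `q`, then `H`
satisfies `λ`-uniqueness, for every `λ ∈ ℝ`, on every subset `Ω ⊆ V` with
`inf_{ω ∈ Ω} h(ω) > −∞`. -/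
theorem height_function_gives_lambdaUniqueness {V E : Type*} (Γ : WSGraph V E)
    (hconn : Γ.Connected) (h : V → ℤ)
    (hA : ∀ x y : V, |h x - h y| ≤ (Γ.pathDist x y : ℤ))
    (hB : ∀ b : V, ∃! c : V, Γ.pathDist b c = 1 ∧ h c = h b + 1)
    (hC : ∀ b : V, ∃ a : V, Γ.pathDist a b = 1 ∧ h a = h b - 1)
    (hSS : Γ.SunadaSy)
    (q : V → ℝ) (hq : ∃ C : ℝ, ∀ x : V, |q x| ≤ C) :
    ∀ (lam : ℝ) (Ω : Set V), BddBelow (h '' Ω) → Γ.LUnique q lam Ω := by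
  intro lam Ω hΩ φ _ hφ hzero
  obtain ⟨m, hm⟩ := hΩ
  have vanish : ∀ (k : ℕ) (x : V), h x < m + k → φ x = 0 := by
    intro k
    induction k with
    | zero =>
      intro x hx
      refine hzero x fun hxΩ => ?_
      have := hm ⟨x, hxΩ, rfl⟩
      simp at hx
      omega
    | succ k ih =>
      intro c hc
      push_cast at hc
      obtain ⟨b, hbc, hh⟩ := hC c
      refine Γ.eq_zero_of_schrod_eq (hSS.1 b) (hφ b) (ih b (by omega))
        (Γ.adj_of_pathDist_eq_one hbc) fun y hby hyc => ih y ?_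
      by_contra hy
      have hd := Γ.pathDist_le_one_of_adj hby
      have hA' := abs_le.1 (hA b y)
      exact hyc ((hB b).unique ⟨by omega, by omega⟩ ⟨hbc, by omega⟩)
  intro x
  refine vanish (h x - m + 1).toNat x ?_
  omega
end
end

section
/- Let (X, d) be a locally finite metric space with uniform growth Vol, and let 𝓕 be a family of nonempty subsets of X. Assume 0 ≤ r < ∞ is a uniform upper bound for the inclusive radii relative to 𝓕, i.e. for every x ∈ X there exists F_x ∈ 𝓕 with F_x ⊆ B(x,r). Then for every subset Ω ⊆ X, the number of r-interior points of Ω satisfies |I(Ω, r)| ≤ Vol(2r) · P(Ω, 𝓕). -/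
noncomputable section

/-- The thick boundary `∂_r Ω = {x ∈ Ω : d(x, X∖Ω) ≤ r}` (with the convention
`d(x, ∅) = ∞`). -/
def rBdry {X : Type*} [MetricSpace X] (Ω : Set X) (r : ℝ) : Set X :=
  {x ∈ Ω | EMetric.infEdist x Ωᶜ ≤ ENNReal.ofReal r}

/-- The `r`-interior `I(Ω,r) = Ω ∖ ∂_r Ω = {x ∈ Ω : d(x, X∖Ω) > r}`. -/
def rInterior {X : Type*} [MetricSpace X] (Ω : Set X) (r : ℝ) : Set X :=
  {x ∈ Ω | ENNReal.ofReal r < EMetric.infEdist x Ωᶜ}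

/-- The packing number `P(Ω, 𝓕)` of `Ω` relative to a family `𝓕` of nonempty
subsets of `X`: the maximal number of pairwise disjoint members of `𝓕`
contained in `Ω` (`0` if no member of `𝓕` is contained in `Ω`). -/
def packNum {X : Type*} (𝓕 : Set (Set X)) (Ω : Set X) : ℕ∞ :=
  ⨆ n ∈ {n : ℕ | ∃ F : Fin n → Set X, (∀ i, F i ∈ 𝓕) ∧
    (Pairwise fun i j => Disjoint (F i) (F j)) ∧ ∀ i, F i ⊆ Ω}, (n : ℕ∞)

/-- Closed `r`-balls around points more than `2r` apart are disjoint. -/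
theorem disjoint_closedBall_of_two_mul_lt_dist {X : Type*} [PseudoMetricSpace X] {x y : X} {r : ℝ}
    (h : 2 * r < dist x y) : Disjoint (Metric.closedBall x r) (Metric.closedBall y r) :=
  Metric.closedBall_disjoint_closedBall (by linarith)

/-- A closed `r`-ball around an `r`-interior point of `Ω` is contained in `Ω`. -/
theorem closedBall_subset_of_mem_rInterior {X : Type*} [MetricSpace X] {Ω : Set X} {r : ℝ} {x : X}
    (hx : x ∈ rInterior Ω r) : Metric.closedBall x r ⊆ Ω := by
  intro y hy
  by_contra hyΩ
  refine hx.2.not_ge ((Metric.infEDist_le_edist_of_mem hyΩ).trans ?_)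
  rw [edist_dist, dist_comm]
  exact ENNReal.ofReal_le_ofReal hy

/-- A family of pairwise disjoint members of `𝓕` inside `Ω` bounds the packing number
from below. -/
theorem encard_le_packNum {X ι : Type*} {𝓕 : Set (Set X)} {Ω : Set X} {N : Set ι} {F : ι → Set X}
    (hF : ∀ i ∈ N, F i ∈ 𝓕) (hd : N.PairwiseDisjoint F) (hΩ : ∀ i ∈ N, F i ⊆ Ω) :
    N.encard ≤ packNum 𝓕 Ω := by
  refine ENat.forall_natCast_le_iff_le.1 fun n hn => ?_
  obtain ⟨t, htN, ht⟩ := Set.exists_subset_encard_eq hn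
  have htf : t.Finite := Set.finite_of_encard_eq_coe ht
  have : Finite t := htf
  have hcard : Nat.card t = n := by
    rw [Nat.card_coe_set_eq, Set.ncard, ht, ENat.toNat_natCast]
  let e := Finite.equivFinOfCardEq hcard
  refine le_iSup₂_of_le (f := fun (n : ℕ) _ => (n : ℕ∞)) n
    ⟨fun i => F (e.symm i), fun i => hF _ (htN (e.symm i).2), fun i j hij => ?_,
      fun i => hΩ _ (htN (e.symm i).2)⟩ le_rfl
  exact hd (htN (e.symm i).2) (htN (e.symm j).2)
    fun h => hij (e.symm.injective (Subtype.ext h))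

/-- A finite union of sets of size at most `V` has at most `V` times as many elements as there
are indices. -/
theorem encard_biUnion_le_mul {X ι : Type*} {V : ℕ∞} {f : ι → Set X} (hf : ∀ i, (f i).encard ≤ V)
    {N : Set ι} (hN : N.Finite) : (⋃ i ∈ N, f i).encard ≤ V * N.encard := by
  induction N, hN using Set.Finite.induction_on with
  | empty => simp
  | @insert a s ha _ ih =>
    rw [Set.biUnion_insert, Set.encard_insert_of_notMem ha, mul_add, mul_one, add_comm]
    exact (Set.encard_union_le _ _).trans (add_le_add (hf a) ih)

/-- Every subset of a metric space contains an `s`-separated set whose closed `s`-balls cover it. -/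
theorem exists_separated_net {X : Type*} [PseudoMetricSpace X] (A : Set X) {s : ℝ} (hs : 0 ≤ s) :
    ∃ N ⊆ A, N.Pairwise (fun x y => s < dist x y) ∧ A ⊆ ⋃ x ∈ N, Metric.closedBall x s := by
  obtain ⟨N, hN⟩ := zorn_subset {N : Set X | N ⊆ A ∧ N.Pairwise fun x y => s < dist x y}
    fun c hc hchain => ⟨⋃₀ c, ⟨Set.sUnion_subset fun t ht => (hc ht).1,
      (Set.pairwise_sUnion hchain.directedOn).2 fun t ht => (hc ht).2⟩,
      fun t ht => Set.subset_sUnion_of_mem ht⟩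
  refine ⟨N, hN.prop.1, hN.prop.2, fun x hx => ?_⟩
  by_contra hcov
  have hfar : ∀ y ∈ N, s < dist x y := by simpa using hcov
  have hmem : x ∈ N := hN.le_of_ge (y := insert x N)
    ⟨Set.insert_subset hx hN.prop.1, hN.prop.2.insert fun y hy _ =>
      ⟨hfar y hy, dist_comm x y ▸ hfar y hy⟩⟩ (Set.subset_insert x N) (Set.mem_insert x N)
  have := hfar x hmem
  rw [dist_self] at this
  exact this.not_ge hs

/-- (Interior points as a lower bound for the packing
number.) Let `(X, d)` be a locally finite metric space with uniform growth
`Vol`, and `𝓕` a family of nonempty subsets of `X`. Assume `0 ≤ r < ∞` is a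
uniform upper bound for the inclusive radii relative to `𝓕`. Then for every
`Ω ⊆ X`, `|I(Ω, r)| ≤ Vol(2r) · P(Ω, 𝓕)`. -/
theorem interior_le_vol_mul_packing {X : Type*} [MetricSpace X]
    (Vol : ℝ → ℕ)
    (hVol : ∀ s : ℝ, 0 ≤ s → (Vol s : ℕ∞) = ⨆ x : X, (Metric.closedBall x s).encard)
    (𝓕 : Set (Set X)) (h𝓕 : ∀ F ∈ 𝓕, F.Nonempty)
    (r : ℝ) (hr : 0 ≤ r)
    (hincl : ∀ x : X, ∃ F ∈ 𝓕, F ⊆ Metric.closedBall x r) :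
    ∀ Ω : Set X, (rInterior Ω r).encard ≤ (Vol (2 * r) : ℕ∞) * packNum 𝓕 Ω := by
  intro Ω
  have hball : ∀ x : X, (Metric.closedBall x (2 * r)).encard ≤ (Vol (2 * r) : ℕ∞) := fun x => by
    rw [hVol (2 * r) (by positivity)]
    exact le_iSup (fun x : X => (Metric.closedBall x (2 * r)).encard) x
  obtain ⟨N, hNsub, hNsep, hNcov⟩ :=
    exists_separated_net (rInterior Ω r) (s := 2 * r) (by positivity)
  choose F hF𝓕 hFball using hincl
  have hpack : N.encard ≤ packNum 𝓕 Ω := encard_le_packNum (F := F) (fun x _ => hF𝓕 x)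
    (fun x hx y hy hxy => (disjoint_closedBall_of_two_mul_lt_dist (hNsep hx hy hxy)).mono
      (hFball x) (hFball y))
    fun x hx => (hFball x).trans (closedBall_subset_of_mem_rInterior (hNsub hx))
  refine le_trans ?_ (mul_le_mul_right hpack _)
  rcases N.finite_or_infinite with hfin | hinf
  · exact (Set.encard_le_encard hNcov).trans (encard_biUnion_le_mul hball hfin)
  · obtain ⟨x, -⟩ := hinf.nonempty
    have hVol0 : (Vol (2 * r) : ℕ∞) ≠ 0 := fun h => by
      have hempty := Set.encard_eq_zero.1 (le_zero_iff.1 (h ▸ hball x))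
      exact (hempty ▸ Metric.mem_closedBall_self (by positivity) : x ∈ (∅ : Set X))
    rw [hinf.encard_eq, ENat.mul_top hVol0]
    exact le_top
end
end

section
/- Let (X, d) be a locally finite metric space with uniform growth Vol whose distance is geodesic with integer values. Let Ω ⊆ X, r > 1, and ε ≥ 0 with Vol(r) · |∂₁Ω| ≤ ε |Ω|. Then the number of r-interior points of Ω satisfies |I(Ω, r)| ≥ (1 − ε)|Ω|. -/
noncomputable section

/-- A distance which is geodesic with integer values. -/
def GeodesicInt (X : Type*) [MetricSpace X] : Prop :=
  (∀ x y : X, ∃ n : ℕ, dist x y = (n : ℝ)) ∧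
  (∀ x z : X, ∀ k : ℕ, (k : ℝ) ≤ dist x z →
    ∃ y : X, dist x y = (k : ℝ) ∧ dist x z = dist x y + dist y z)

/-- Walking along a geodesic from a point of `Ω` to a point outside `Ω`, one meets `∂₁Ω`. -/
theorem GeodesicInt.exists_mem_rBdry_one {X : Type*} [MetricSpace X] (hgeo : GeodesicInt X)
    {Ω : Set X} {y : X} (hy : y ∉ Ω) (n : ℕ) {x : X} (hx : x ∈ Ω) (hxy : dist x y = n) :
    ∃ z ∈ rBdry Ω 1, dist x z ≤ n := by
  induction n generalizing x with
  | zero =>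
    rw [Nat.cast_zero, dist_eq_zero] at hxy
    exact absurd (hxy ▸ hx) hy
  | succ n ih =>
    push_cast at hxy ⊢
    obtain ⟨w, hw, hwy⟩ := hgeo.2 x y 1 (by rw [hxy]; push_cast; linarith [n.cast_nonneg (α := ℝ)])
    rw [Nat.cast_one] at hw
    by_cases hwΩ : w ∈ Ω
    · obtain ⟨z, hz, hwz⟩ := ih hwΩ (by linarith)
      exact ⟨z, hz, by linarith [dist_triangle x w z]⟩
    · refine ⟨x, ⟨hx, ?_⟩, by rw [dist_self]; positivity⟩
      refine (Metric.infEDist_le_edist_of_mem (show w ∈ Ωᶜ from hwΩ)).trans ?_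
      rw [edist_dist, hw]

/-- The thick boundary `∂_r Ω` lies in the `r`-neighbourhood of `∂₁Ω`. -/
theorem GeodesicInt.rBdry_subset_biUnion_closedBall {X : Type*} [MetricSpace X]
    (hgeo : GeodesicInt X) (Ω : Set X) {r : ℝ} (hr : 0 ≤ r) :
    rBdry Ω r ⊆ ⋃ z ∈ rBdry Ω 1, Metric.closedBall z r := by
  rintro x ⟨hx, hxr⟩
  have hlt : Metric.infEDist x Ωᶜ < ENNReal.ofReal (⌊r⌋₊ + 1) :=
    hxr.trans_lt ((ENNReal.ofReal_lt_ofReal_iff (by positivity)).2 (Nat.lt_floor_add_one r))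
  obtain ⟨y, hy, hxy⟩ := Metric.infEDist_lt_iff.1 hlt
  rw [edist_dist, ENNReal.ofReal_lt_ofReal_iff (by positivity)] at hxy
  obtain ⟨n, hn⟩ := hgeo.1 x y
  have hnr : n ≤ ⌊r⌋₊ := by
    rw [hn] at hxy
    exact Nat.lt_succ_iff.1 (by exact_mod_cast hxy)
  obtain ⟨z, hz, hxz⟩ := hgeo.exists_mem_rBdry_one hy n hx hn
  exact Set.mem_biUnion hz (hxz.trans ((Nat.le_floor_iff hr).1 hnr))

/-- A finite union of sets with at most `N` elements each, indexed by `T`, has at most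
`N * |T|` elements. -/
theorem Set.Finite.encard_biUnion_le_mul {α β : Type*} {T : Set α} (hT : T.Finite)
    (f : α → Set β) (N : ℕ∞) (hf : ∀ a ∈ T, (f a).encard ≤ N) :
    (⋃ a ∈ T, f a).encard ≤ N * T.encard := by
  induction T, hT using Set.Finite.induction_on with
  | empty => simp
  | @insert a S ha _ ih =>
    rw [Set.biUnion_insert, Set.encard_insert_of_notMem ha, mul_add, mul_one, add_comm]
    exact (Set.encard_union_le _ _).trans <| add_le_add (hf a (Set.mem_insert a S))
      (ih fun b hb => hf b (Set.mem_insert_of_mem a hb))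

/-- (Følner to bound below interior points.) Let `(X, d)` be
a locally finite metric space with uniform growth `Vol` whose distance is
geodesic with integer values. Let `Ω ⊆ X` (a finite set), `r > 1`, and `ε ≥ 0`
with `Vol(r) · |∂₁Ω| ≤ ε |Ω|`. Then `|I(Ω, r)| ≥ (1 − ε)|Ω|`. -/
theorem folner_interior_bound {X : Type*} [MetricSpace X]
    (Vol : ℝ → ℕ)
    (hVol : ∀ s : ℝ, 0 ≤ s → (Vol s : ℕ∞) = ⨆ x : X, (Metric.closedBall x s).encard)
    (hgeo : GeodesicInt X)
    (Ω : Set X) (hΩ : Ω.Finite) (r : ℝ) (hr : 1 < r)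
    (ε : ℝ) (hε : 0 ≤ ε)
    (hbound : (Vol r : ℝ) * ((rBdry Ω 1).ncard : ℝ) ≤ ε * (Ω.ncard : ℝ)) :
    (1 - ε) * (Ω.ncard : ℝ) ≤ ((rInterior Ω r).ncard : ℝ) := by
  have hr0 : 0 ≤ r := by linarith
  have hfin : ∀ t, (rBdry Ω t).Finite := fun t => hΩ.subset (Set.sep_subset _ _)
  have hball : ∀ z ∈ rBdry Ω 1, (Metric.closedBall z r).encard ≤ Vol r := fun z _ => by
    rw [hVol r hr0]
    exact le_iSup (fun x : X => (Metric.closedBall x r).encard) z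
  have hcard : (rBdry Ω r).ncard ≤ Vol r * (rBdry Ω 1).ncard := by
    have h := (Set.encard_le_encard (hgeo.rBdry_subset_biUnion_closedBall Ω hr0)).trans
      ((hfin 1).encard_biUnion_le_mul _ _ hball)
    rw [← (hfin r).cast_ncard_eq, ← (hfin 1).cast_ncard_eq] at h
    exact_mod_cast h
  have hsplit : Ω ⊆ rBdry Ω r ∪ rInterior Ω r := fun x hx =>
    (le_or_gt (Metric.infEDist x Ωᶜ) (ENNReal.ofReal r)).imp (⟨hx, ·⟩) (⟨hx, ·⟩)
  have hsum : Ω.ncard ≤ (rBdry Ω r).ncard + (rInterior Ω r).ncard :=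
    (Set.ncard_le_ncard hsplit ((hfin r).union (hΩ.subset (Set.sep_subset _ _)))).trans
      (Set.ncard_union_le _ _)
  have hcard' : ((rBdry Ω r).ncard : ℝ) ≤ Vol r * (rBdry Ω 1).ncard := by exact_mod_cast hcard
  have hsum' : (Ω.ncard : ℝ) ≤ (rBdry Ω r).ncard + (rInterior Ω r).ncard := by
    exact_mod_cast hsum
  linarith
end
end
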